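/- Let Λ = U³ ⊕ E8² ⊕ ⟨−2⟩ and let g ∈ Λ with B(g,g) = −2 and div_Λ(g) = 1. Then the orthogonal complement g^⊥ = {x ∈ Λ : B(g,x) = 0} is isometric to ⟨2⟩ ⊕ U² ⊕ E8² ⊕ ⟨−2⟩. -/

import Mathlib

open Matrix

/-- The Gram pairing `(x, y) ↦ xᵀ G y` of an integer matrix `G`, as a bilinear map. -/
def gramBilin {n : ℕ} (G : Matrix (Fin n) (Fin n) ℤ) :
    (Fin n → ℤ) →ₗ[ℤ] (Fin n → ℤ) →ₗ[ℤ] ℤ :=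
  Matrix.toLinearMap₂' ℤ G

/-- The hyperbolic plane `U`, with Gram matrix `[[0,1],[1,0]]`. -/
def UGram : Matrix (Fin 2) (Fin 2) ℤ := !![0, 1; 1, 0]

/-- `U(2)`, with Gram matrix `[[0,2],[2,0]]`. -/
def U2Gram : Matrix (Fin 2) (Fin 2) ℤ := !![0, 2; 2, 0]

/-- `⟨2⟩ ⊕ ⟨-2⟩`. -/
def diag2Gram : Matrix (Fin 2) (Fin 2) ℤ := !![2, 0; 0, -2]

/-- The (negative definite even unimodular) `E8` lattice: the negative of the E₈ Cartan matrix. -/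
def E8Gram : Matrix (Fin 8) (Fin 8) ℤ := -CartanMatrix.E₈

/-- The rank-one lattice `⟨k⟩`. -/
def rankOneGram (k : ℤ) : Matrix (Fin 1) (Fin 1) ℤ := !![k]

/-- Orthogonal direct sum of two bilinear forms, on the product module. -/
def prodBilin {M N : Type*} [AddCommGroup M] [AddCommGroup N] [Module ℤ M] [Module ℤ N]
    (BM : M →ₗ[ℤ] M →ₗ[ℤ] ℤ) (BN : N →ₗ[ℤ] N →ₗ[ℤ] ℤ) :
    (M × N) →ₗ[ℤ] (M × N) →ₗ[ℤ] ℤ :=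
  LinearMap.mk₂ ℤ (fun x y => BM x.1 y.1 + BN x.2 y.2)
    (by intro m₁ m₂ n; simp [map_add]; ring)
    (by intro c m n; simp [_root_.map_smul, smul_eq_mul]; ring)
    (by intro m n₁ n₂; simp [map_add]; ring)
    (by intro c m n; simp [_root_.map_smul, smul_eq_mul]; ring)

/-- The underlying module of `Λ = U³ ⊕ E8² ⊕ ⟨-2⟩`. -/
abbrev LambdaM : Type :=
  (Fin 2 → ℤ) × (Fin 2 → ℤ) × (Fin 2 → ℤ) × (Fin 8 → ℤ) × (Fin 8 → ℤ) × (Fin 1 → ℤ)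

/-- The bilinear form of the Beauville–Bogomolov lattice `Λ = U³ ⊕ E8² ⊕ ⟨-2⟩`. -/
def LambdaB : LambdaM →ₗ[ℤ] LambdaM →ₗ[ℤ] ℤ :=
  prodBilin (gramBilin UGram) <| prodBilin (gramBilin UGram) <| prodBilin (gramBilin UGram) <|
    prodBilin (gramBilin E8Gram) <| prodBilin (gramBilin E8Gram) (gramBilin (rankOneGram (-2)))

/-- Membership in `O(Λ)`: a linear automorphism preserving the form. -/
def IsIsometry (f : LambdaM ≃ₗ[ℤ] LambdaM) : Prop :=
  ∀ x y, LambdaB (f x) (f y) = LambdaB x y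

/-- The invariant sublattice `Λ^ι = {x | ι x = x}`. -/
def invLattice (f : LambdaM ≃ₗ[ℤ] LambdaM) : Submodule ℤ LambdaM :=
  LinearMap.eqLocus (f : LambdaM →ₗ[ℤ] LambdaM) (LinearMap.id)

/-- A submodule of `Λ`, with the restricted form, is isometric to the lattice `(N, BN)`. -/
def IsometricTo {N : Type*} [AddCommGroup N] [Module ℤ N]
    (K : Submodule ℤ LambdaM) (BN : N →ₗ[ℤ] N →ₗ[ℤ] ℤ) : Prop :=
  ∃ e : K ≃ₗ[ℤ] N, ∀ x y : K, BN (e x) (e y) = LambdaB (x : LambdaM) (y : LambdaM)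

/-- `div_Λ(v) = d`: the ideal of values `B(v, ·)` is generated by the positive integer `d`. -/
def HasDivisibility (v : LambdaM) (d : ℤ) : Prop :=
  0 < d ∧ (∀ x, d ∣ LambdaB v x) ∧ ∃ x, LambdaB v x = d

/-- Conjugacy in `O(Λ)`: `ι' = γ ∘ ι ∘ γ⁻¹` for some isometry `γ`. -/
def ConjInO (ι ι' : LambdaM ≃ₗ[ℤ] LambdaM) : Prop :=
  ∃ γ : LambdaM ≃ₗ[ℤ] LambdaM, IsIsometry γ ∧ ∀ x, ι' x = γ (ι (γ.symm x))

/-- A sublattice has signature (1,1): rank two, containing both an element of positive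
square and an element of negative square. -/
def SigOneOne (K : Submodule ℤ LambdaM) : Prop :=
  Module.finrank ℤ K = 2 ∧ (∃ x ∈ K, 0 < LambdaB x x) ∧ (∃ x ∈ K, LambdaB x x < 0)

/-- The orthogonal complement of a submodule of `Λ`. -/
def perpOf (K : Submodule ℤ LambdaM) : Submodule ℤ LambdaM where
  carrier := {x | ∀ s ∈ K, LambdaB x s = 0}
  add_mem' := by
    intro a b ha hb s hs
    simp [map_add, LinearMap.add_apply, ha s hs, hb s hs]
  zero_mem' := by
    intro s hs
    simp
  smul_mem' := by
    intro c a ha s hs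
    simp only [_root_.map_smul, LinearMap.smul_apply, ha s hs, smul_zero]

/-- The bilinear form of the lattice `⟨2⟩ ⊕ U² ⊕ E8² ⊕ ⟨−2⟩`. -/
def TargetB12 :
    ((Fin 1 → ℤ) × (Fin 2 → ℤ) × (Fin 2 → ℤ) × (Fin 8 → ℤ) × (Fin 8 → ℤ) × (Fin 1 → ℤ)) →ₗ[ℤ]
      ((Fin 1 → ℤ) × (Fin 2 → ℤ) × (Fin 2 → ℤ) × (Fin 8 → ℤ) × (Fin 8 → ℤ) × (Fin 1 → ℤ))
        →ₗ[ℤ] ℤ :=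
  prodBilin (gramBilin (rankOneGram 2)) <| prodBilin (gramBilin UGram) <|
    prodBilin (gramBilin UGram) <| prodBilin (gramBilin E8Gram) <|
      prodBilin (gramBilin E8Gram) (gramBilin (rankOneGram (-2)))

section Eichler

variable {L : Type*} [AddCommGroup L]

/-- Two elements of a lattice lie in the same orbit of its isometry group. -/
def SameOrbit (B : L →ₗ[ℤ] L →ₗ[ℤ] ℤ) (v w : L) : Prop :=
  ∃ φ : L ≃ₗ[ℤ] L, (∀ x y, B (φ x) (φ y) = B x y) ∧ φ v = w

namespace SameOrbit

variable {B : L →ₗ[ℤ] L →ₗ[ℤ] ℤ}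

theorem refl (v : L) : SameOrbit B v v :=
  ⟨LinearEquiv.refl ℤ L, fun _ _ => rfl, rfl⟩

theorem trans {u v w : L} (h₁ : SameOrbit B u v) (h₂ : SameOrbit B v w) : SameOrbit B u w := by
  obtain ⟨φ, hφ, rfl⟩ := h₁
  obtain ⟨ψ, hψ, rfl⟩ := h₂
  exact ⟨φ.trans ψ, fun x y => by simp [hφ, hψ], rfl⟩

theorem neg (v : L) : SameOrbit B v (-v) :=
  ⟨LinearEquiv.neg ℤ, fun x y => by simp, by simp⟩

theorem apply_self {v w : L} (h : SameOrbit B v w) : B w w = B v v := by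
  obtain ⟨φ, hφ, rfl⟩ := h
  exact hφ v v

theorem exists_apply_eq {v w : L} (h : SameOrbit B v w) {n : ℤ} (hv : ∃ y, B v y = n) :
    ∃ y, B w y = n := by
  obtain ⟨φ, hφ, rfl⟩ := h
  obtain ⟨y, rfl⟩ := hv
  exact ⟨φ y, hφ v y⟩

end SameOrbit

/-- The linear map underlying the Eichler transvection attached to an isotropic vector `e` and a
vector `a` orthogonal to `e` with `B a a = 2 * k`. -/
def eichlerMap (B : L →ₗ[ℤ] L →ₗ[ℤ] ℤ) (e a : L) (k : ℤ) : L →ₗ[ℤ] L :=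
  LinearMap.id - (B a).smulRight e + (B e).smulRight a - (B e).smulRight (k • e)

theorem eichlerMap_apply (B : L →ₗ[ℤ] L →ₗ[ℤ] ℤ) (e a : L) (k : ℤ) (x : L) :
    eichlerMap B e a k x = x - B a x • e + B e x • a - B e x • (k • e) := by
  simp [eichlerMap]

variable {B : L →ₗ[ℤ] L →ₗ[ℤ] ℤ}

theorem eichlerMap_neg_eichlerMap (hB : ∀ x y, B x y = B y x) {e a : L} {k : ℤ}
    (he : B e e = 0) (hea : B e a = 0) (ha : B a a = 2 * k) (x : L) :
    eichlerMap B e (-a) k (eichlerMap B e a k x) = x := by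
  have hae : B a e = 0 := by rw [hB, hea]
  simp only [eichlerMap_apply, map_add, map_sub, map_neg, _root_.map_smul, LinearMap.neg_apply,
    he, hea, hae, ha]
  module

/-- The Eichler transvection as an automorphism. -/
def eichlerEquiv (hB : ∀ x y, B x y = B y x) {e a : L} {k : ℤ}
    (he : B e e = 0) (hea : B e a = 0) (ha : B a a = 2 * k) : L ≃ₗ[ℤ] L :=
  LinearEquiv.ofLinearMap (eichlerMap B e a k) (eichlerMap B e (-a) k)
    (LinearMap.ext fun x => by
      have h := eichlerMap_neg_eichlerMap hB (a := -a) (k := k) he (by simp [hea]) (by simp [ha]) x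
      rwa [neg_neg] at h)
    (LinearMap.ext fun x => eichlerMap_neg_eichlerMap hB he hea ha x)

theorem sameOrbit_eichler (hB : ∀ x y, B x y = B y x) {e a : L} {k : ℤ}
    (he : B e e = 0) (hea : B e a = 0) (ha : B a a = 2 * k) (v : L) :
    SameOrbit B v (v - B a v • e + B e v • a - B e v • (k • e)) := by
  refine ⟨eichlerEquiv hB he hea ha, fun x y => ?_, eichlerMap_apply B e a k v⟩
  have hae : B a e = 0 := by rw [hB, hea]
  change B (eichlerMap B e a k x) (eichlerMap B e a k y) = B x y
  simp only [eichlerMap_apply, map_add, map_sub, _root_.map_smul, LinearMap.add_apply,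
    LinearMap.sub_apply, LinearMap.smul_apply, smul_eq_mul, he, hea, hae, ha, hB x e, hB x a]
  ring

/-- The transvection attached to two orthogonal isotropic vectors. -/
theorem sameOrbit_isotropic (hB : ∀ x y, B x y = B y x) {e a : L}
    (he : B e e = 0) (ha : B a a = 0) (hea : B e a = 0) (s : ℤ) (v : L) :
    SameOrbit B v (v - (s * B a v) • e + (s * B e v) • a) := by
  have h := sameOrbit_eichler hB (a := s • a) (k := 0) he (by simp [hea]) (by simp [ha]) v
  convert h using 1
  simp only [_root_.map_smul, LinearMap.smul_apply, smul_eq_mul]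
  module

/-- Eichler's criterion for vectors of divisibility one in an even lattice containing two
orthogonal hyperbolic planes `⟨e, f⟩` and `⟨e', f'⟩`: such a vector is equivalent to one pairing
to `1` with `f`. -/
theorem exists_sameOrbit_apply_eq_one (hB : ∀ x y, B x y = B y x) (heven : ∀ x, Even (B x x))
    {e f e' f' : L} (hee : B e e = 0) (hff : B f f = 0) (hef : B e f = 1)
    (hee' : B e' e' = 0) (hff' : B f' f' = 0) (hef' : B e' f' = 1)
    (h₁ : B e e' = 0) (h₂ : B e f' = 0) (h₃ : B f e' = 0) (h₄ : B f f' = 0)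
    {v : L} (hv : ∃ y, B v y = 1) :
    ∃ w, SameOrbit B v w ∧ B f w = 1 := by
  have hfe : B f e = 1 := by rw [hB, hef]
  have hfe' : B f' e' = 1 := by rw [hB, hef']
  have h₁' : B e' e = 0 := by rw [hB, h₁]
  have h₂' : B f' e = 0 := by rw [hB, h₂]
  -- an orbit element orthogonal to the second plane can be translated by `-e'`
  have translate : ∀ w, SameOrbit B v w → B e' w = 0 → B f' w = 0 →
      SameOrbit B v (w - e') := by
    intro w hw hd hc
    obtain ⟨y, hy⟩ := hw.exists_apply_eq hv
    obtain ⟨k, hk⟩ := heven (y - B e' y • f')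
    have h := sameOrbit_eichler hB (e := e') (a := y - B e' y • f') (k := k) hee'
      (by simp [hef']) (by rw [hk]; ring) w
    have hyw : B y w = 1 := by rw [hB, hy]
    have := hw.trans h
    simpa [hd, hc, hyw] using this
  have pos_of_ne : ∀ w, SameOrbit B v w → B f w ≠ 0 → ∃ w, SameOrbit B v w ∧ 0 < B f w := by
    intro w hw h0
    rcases lt_or_gt_of_ne h0 with h | h
    · exact ⟨-w, hw.trans (.neg w), by simpa using h⟩
    · exact ⟨w, hw, h⟩
  have pos_of_ne_f' : ∀ w, SameOrbit B v w → B f' w ≠ 0 →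
      ∃ w, SameOrbit B v w ∧ 0 < B f w := by
    intro w hw h0
    by_cases ha : B f w = 0
    · refine pos_of_ne _ (hw.trans (sameOrbit_isotropic hB hee hff' h₂ 1 w)) ?_
      simp [ha, hfe, h₄, h0]
    · exact pos_of_ne w hw ha
  have exists_pos : ∃ w, SameOrbit B v w ∧ 0 < B f w := by
    by_cases hc : B f' v = 0
    · by_cases hd : B e' v = 0
      · exact pos_of_ne_f' _ (translate v (.refl v) hd hc) (by simp [hc, hfe'])
      · by_cases ha : B f v = 0
        · refine pos_of_ne _ (sameOrbit_isotropic hB hee hee' h₁ 1 v) ?_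
          simp [ha, hfe, h₃, hd]
        · exact pos_of_ne v (.refl v) ha
    · exact pos_of_ne_f' v (.refl v) hc
  have exists_min : ∃ n : ℕ, ∃ w, SameOrbit B v w ∧ B f w = n ∧ 0 < n := by
    obtain ⟨w, hw, h⟩ := exists_pos
    exact ⟨(B f w).toNat, w, hw, by omega, by omega⟩
  classical
  obtain ⟨w, hw, hn, hpos⟩ := Nat.find_spec exists_min
  set n := Nat.find exists_min with hndef
  have minimal : ∀ w, SameOrbit B v w → 0 < B f w → (n : ℤ) ≤ B f w := by
    intro u hu h
    have : n ≤ (B f u).toNat := Nat.find_min' exists_min ⟨u, hu, by omega, by omega⟩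
    omega
  -- the descent step: values on an isotropic `u` orthogonal to `⟨e, f⟩` are divisible by `n`
  have descent : ∀ u, B u u = 0 → B e u = 0 → B f u = 0 → (∃ u', B u' u = 1 ∧ B u' u' = 0 ∧
      B f u' = 0 ∧ B e u' = 0) →
      ∀ w, SameOrbit B v w → B f w = n → (n : ℤ) ∣ B u w := by
    rintro u huu heu hfu ⟨u', hu'u, hu'u', hfu', heu'⟩ w hw hwn
    have hue : B u e = 0 := by rw [hB, heu]
    have huf : B u f = 0 := by rw [hB, hfu]
    have huu' : B u u' = 1 := by rw [hB, hu'u]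
    have H := hw.trans (sameOrbit_isotropic hB hff hu'u' hfu' (-(B u w / n)) w)
    set x := w - (-(B u w / n) * B u' w) • f + (-(B u w / n) * B f w) • u' with hx
    have hux : B u x = B u w % n := by
      rw [Int.emod_def]
      simp [hx, huf, huu', hwn]; ring
    have hfx : B f x = n := by simp [hx, hff, hfu', hwn]
    have hlt : B u x < n := hux ▸ Int.emod_lt_of_pos _ (by omega)
    have hnn : 0 ≤ B u x := hux ▸ Int.emod_nonneg _ (by omega)
    rcases hnn.eq_or_lt with h0 | h0
    · exact Int.dvd_of_emod_eq_zero (by omega)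
    · exfalso
      have H' := H.trans (sameOrbit_isotropic hB hee huu heu (((n : ℤ) - 1) / B u x) x)
      have e1 := minimal _ H'
      have e2 : (n : ℤ) - 1 - B u x * (((n : ℤ) - 1) / B u x) = ((n : ℤ) - 1) % B u x :=
        (Int.emod_def _ _).symm
      have e3 := Int.emod_nonneg ((n : ℤ) - 1) h0.ne'
      have e4 := Int.emod_lt_of_pos ((n : ℤ) - 1) h0
      simp only [map_add, map_sub, _root_.map_smul, smul_eq_mul, hfx, hfe, hfu, mul_one, mul_zero,
        add_zero] at e1
      have e5 := mul_comm (B u x) (((n : ℤ) - 1) / B u x)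
      have := e1 (by linarith)
      linarith
  have dvd_e' := descent e' hee' h₁ h₃ ⟨f', hfe', hff', h₄, h₂⟩
  have dvd_f' := descent f' hff' h₂ h₄ ⟨e', hef', hee', h₃, h₁⟩
  obtain ⟨c, hc⟩ := dvd_f' w hw hn
  have hf'f : B f' f = 0 := by rw [hB, h₄]
  have H := hw.trans (sameOrbit_isotropic hB hff hee' h₃ (-c) w)
  set x := w - (-c * B e' w) • f + (-c * B f w) • e' with hx
  have hfx : B f x = n := by simp [hx, hff, h₃, hn]
  have hf'x : B f' x = 0 := by simp [hx, hf'f, hfe', hn, hc]; ring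
  obtain ⟨d, hd⟩ := dvd_e' x H hfx
  have H' := H.trans (sameOrbit_isotropic hB hff hff' h₄ (-d) x)
  set z := x - (-d * B f' x) • f + (-d * B f x) • f' with hz
  have hfz : B f z = n := by simp [hz, hff, h₄, hfx]
  have hf'z : B f' z = 0 := by simp [hz, hf'x, hff']
  have he'z : B e' z = 0 := by simp [hz, hef', hfx, hf'x, hd]; ring
  have h := dvd_f' _ (translate z H' he'z hf'z) (by simp [hfz, h₃])
  simp only [map_sub, hf'z, hfe', zero_sub, dvd_neg] at h
  refine ⟨w, hw, ?_⟩
  have := Int.eq_one_of_dvd_one (by omega) h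
  omega

/-- In an even lattice containing two orthogonal hyperbolic planes, a vector of divisibility one
and square `2 * m` is equivalent to `e + m • f`. -/
theorem sameOrbit_add_smul (hB : ∀ x y, B x y = B y x) (heven : ∀ x, Even (B x x))
    {e f e' f' : L} (hee : B e e = 0) (hff : B f f = 0) (hef : B e f = 1)
    (hee' : B e' e' = 0) (hff' : B f' f' = 0) (hef' : B e' f' = 1)
    (h₁ : B e e' = 0) (h₂ : B e f' = 0) (h₃ : B f e' = 0) (h₄ : B f f' = 0)
    {v : L} (hv : ∃ y, B v y = 1) {m : ℤ} (hm : B v v = 2 * m) :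
    SameOrbit B v (e + m • f) := by
  obtain ⟨w, hw, hfw⟩ :=
    exists_sameOrbit_apply_eq_one hB heven hee hff hef hee' hff' hef' h₁ h₂ h₃ h₄ hv
  have hfe : B f e = 1 := by rw [hB, hef]
  obtain ⟨k, hk⟩ := heven (e - w)
  have H := hw.trans (sameOrbit_eichler hB (e := f) (a := e - w) (k := k) hff
    (by simp [hfe, hfw]) (by rw [hk]; ring) w)
  have key : w - B (e - w) w • f + B f w • (e - w) - B f w • (k • f)
      = e + (-B (e - w) w - k) • f := by
    rw [hfw]; module
  rw [key] at H
  have hsq := H.apply_self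
  set c := -B (e - w) w - k
  have : c = m := by
    simp [hee, hff, hef, hfe, hm] at hsq
    omega
  rwa [this] at H

end Eichler

theorem gramBilin_comm {n : ℕ} {G : Matrix (Fin n) (Fin n) ℤ} (hG : G.IsSymm)
    (x y : Fin n → ℤ) : gramBilin G x y = gramBilin G y x := by
  simp only [gramBilin, Matrix.toLinearMap₂'_apply']
  rw [Matrix.dotProduct_mulVec, ← Matrix.mulVec_transpose, hG.eq, dotProduct_comm]

theorem gramBilin_single {n : ℕ} (G : Matrix (Fin n) (Fin n) ℤ) (i j : Fin n) :
    gramBilin G (Pi.single i 1) (Pi.single j 1) = G i j := by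
  rw [gramBilin, Matrix.toLinearMap₂'_apply', Matrix.mulVec_single_one, single_one_dotProduct]
  rfl

theorem even_gramBilin_self {n : ℕ} {G : Matrix (Fin n) (Fin n) ℤ} (hG : G.IsSymm)
    (hdiag : ∀ i, Even (G i i)) (x : Fin n → ℤ) : Even (gramBilin G x x) := by
  have h : ∀ s : Finset (Fin n), Even (gramBilin G (∑ i ∈ s, x i • Pi.single i 1)
      (∑ i ∈ s, x i • Pi.single i 1)) := by
    intro s
    induction s using Finset.induction_on with
    | empty => simp
    | insert i s hi ih =>
      rw [Finset.sum_insert hi]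
      set z := ∑ i ∈ s, x i • (Pi.single i 1 : Fin n → ℤ)
      have hii : gramBilin G (x i • Pi.single i 1) (x i • Pi.single i 1) = x i * (x i * G i i) := by
        rw [_root_.map_smul, _root_.map_smul, LinearMap.smul_apply]
        exact congrArg (fun t => x i * (x i * t)) (gramBilin_single G i i)
      rw [map_add, map_add, LinearMap.add_apply, LinearMap.add_apply, hii,
        gramBilin_comm hG z (x i • Pi.single i 1)]
      have := ((hdiag i).mul_left (x i)).mul_left (x i)
      rw [show ∀ p q r : ℤ, p + q + (q + r) = p + (q + q) + r by intros; ring]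
      exact (this.add ⟨_, rfl⟩).add ih
  have hx : x = ∑ i, x i • (Pi.single i 1 : Fin n → ℤ) := by
    ext j
    simp [Finset.sum_apply, Pi.single_apply]
  rw [hx]
  exact h Finset.univ

section Prod

variable {M N : Type*} [AddCommGroup M] [AddCommGroup N] {BM : M →ₗ[ℤ] M →ₗ[ℤ] ℤ}
  {BN : N →ₗ[ℤ] N →ₗ[ℤ] ℤ}

theorem prodBilin_apply (BM : M →ₗ[ℤ] M →ₗ[ℤ] ℤ) (BN : N →ₗ[ℤ] N →ₗ[ℤ] ℤ) (x y : M × N) :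
    prodBilin BM BN x y = BM x.1 y.1 + BN x.2 y.2 := rfl

theorem prodBilin_comm (hM : ∀ x y, BM x y = BM y x) (hN : ∀ x y, BN x y = BN y x) (x y : M × N) :
    prodBilin BM BN x y = prodBilin BM BN y x := by
  simp only [prodBilin_apply, hM x.1, hN x.2]

theorem even_prodBilin_self (hM : ∀ x, Even (BM x x)) (hN : ∀ x, Even (BN x x)) (x : M × N) :
    Even (prodBilin BM BN x x) :=
  (hM x.1).add (hN x.2)

end Prod

theorem isSymm_UGram : UGram.IsSymm := by unfold UGram; decide

theorem isSymm_E8Gram : E8Gram.IsSymm := by unfold E8Gram; decide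

theorem isSymm_rankOneGram (k : ℤ) : (rankOneGram k).IsSymm := by
  ext i j
  rw [Matrix.transpose_apply, Subsingleton.elim i j]

theorem LambdaB_comm (x y : LambdaM) : LambdaB x y = LambdaB y x :=
  have hU := gramBilin_comm isSymm_UGram
  have hE := gramBilin_comm isSymm_E8Gram
  prodBilin_comm hU (prodBilin_comm hU (prodBilin_comm hU (prodBilin_comm hE
    (prodBilin_comm hE (gramBilin_comm (isSymm_rankOneGram _)))))) x y

theorem even_LambdaB_self (x : LambdaM) : Even (LambdaB x x) :=
  have hU := even_gramBilin_self isSymm_UGram (by unfold UGram; decide)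
  have hE := even_gramBilin_self isSymm_E8Gram (by unfold E8Gram; decide)
  even_prodBilin_self hU (even_prodBilin_self hU (even_prodBilin_self hU (even_prodBilin_self hE
    (even_prodBilin_self hE (even_gramBilin_self (isSymm_rankOneGram _)
      (by unfold rankOneGram; decide)))))) x

theorem gramBilin_UGram_apply (x y : Fin 2 → ℤ) :
    gramBilin UGram x y = x 0 * y 1 + x 1 * y 0 := by
  simp [gramBilin, UGram, Matrix.toLinearMap₂'_apply', dotProduct, Matrix.mulVec,
    Fin.sum_univ_two]

theorem gramBilin_rankOneGram_apply (k : ℤ) (x y : Fin 1 → ℤ) :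
    gramBilin (rankOneGram k) x y = k * (x 0 * y 0) := by
  simp [gramBilin, rankOneGram, Matrix.toLinearMap₂'_apply', dotProduct, Matrix.mulVec]
  ring

/-- The orthogonal complement of a vector is transported by isometries of `Λ`. -/
theorem IsometricTo.ker_of_sameOrbit {N : Type*} [AddCommGroup N] {BN : N →ₗ[ℤ] N →ₗ[ℤ] ℤ}
    {v w : LambdaM} (h : SameOrbit LambdaB v w)
    (hw : IsometricTo (LinearMap.ker (LambdaB w)) BN) :
    IsometricTo (LinearMap.ker (LambdaB v)) BN := by
  obtain ⟨φ, hφ, rfl⟩ := h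
  obtain ⟨ε, hε⟩ := hw
  have hmap : (LinearMap.ker (LambdaB v)).map (φ : LambdaM →ₗ[ℤ] LambdaM)
      = LinearMap.ker (LambdaB (φ v)) := by
    ext x
    constructor
    · rintro ⟨y, hy, rfl⟩
      exact (hφ v y).trans hy
    · intro hx
      refine ⟨φ.symm x, ?_, φ.apply_symm_apply x⟩
      have := hφ v (φ.symm x)
      rw [φ.apply_symm_apply] at this
      exact this.symm.trans hx
  exact ⟨(φ.ofSubmodules _ _ hmap).trans ε, fun x y => (hε _ _).trans (hφ x y)⟩

theorem isometricTo_ker_LambdaB_sub :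
    IsometricTo (LinearMap.ker (LambdaB ((![1, -1], 0) : LambdaM))) TargetB12 := by
  have hker (x : LambdaM) : LambdaB ((![1, -1], 0) : LambdaM) x = x.1 1 - x.1 0 := by
    rw [LambdaB, prodBilin_apply, gramBilin_UGram_apply]
    simp; ring
  have hmem (x : LinearMap.ker (LambdaB ((![1, -1], 0) : LambdaM))) :
      (x : LambdaM).1 1 = (x : LambdaM).1 0 := by
    have := hker x
    rw [LinearMap.mem_ker.mp x.2] at this
    omega
  refine ⟨
    { toFun := fun x => (fun _ => (x : LambdaM).1 0, (x : LambdaM).2)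
      map_add' := fun x y => rfl
      map_smul' := fun c x => rfl
      invFun := fun y => ⟨(fun _ => y.1 0, y.2), by rw [LinearMap.mem_ker, hker]; simp⟩
      left_inv := fun x => ?_
      right_inv := fun y => ?_ }, fun x y => ?_⟩
  · refine Subtype.ext (Prod.ext (funext fun i => ?_) rfl)
    fin_cases i
    · rfl
    · exact (hmem x).symm
  · refine Prod.ext (funext fun i => ?_) rfl
    rw [Subsingleton.elim i 0]
  · change gramBilin (rankOneGram 2) (fun _ => (x : LambdaM).1 0) (fun _ => (y : LambdaM).1 0) + _ =
      gramBilin UGram (x : LambdaM).1 (y : LambdaM).1 + _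
    congr 1
    rw [gramBilin_rankOneGram_apply, gramBilin_UGram_apply, hmem x, hmem y]
    ring

/-- If `g ∈ Λ = U³ ⊕ E8² ⊕ ⟨−2⟩` has `B(g,g) = −2` and `div_Λ(g) = 1`, then the orthogonal
complement `g^⊥ = {x ∈ Λ : B(g,x) = 0}` is isometric to `⟨2⟩ ⊕ U² ⊕ E8² ⊕ ⟨−2⟩`. -/
theorem perp_of_div_one
    (g : LambdaM) (hgsq : LambdaB g g = -2) (hdiv : HasDivisibility g 1) :
    IsometricTo (LinearMap.ker (LambdaB g)) TargetB12 := by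
  refine .ker_of_sameOrbit ?_ isometricTo_ker_LambdaB_sub
  have h := sameOrbit_add_smul LambdaB_comm even_LambdaB_self
    (e := (![1, 0], 0)) (f := (![0, 1], 0)) (e' := (0, ![1, 0], 0)) (f' := (0, ![0, 1], 0))
    (by simp [LambdaB, prodBilin_apply, gramBilin_UGram_apply])
    (by simp [LambdaB, prodBilin_apply, gramBilin_UGram_apply])
    (by simp [LambdaB, prodBilin_apply, gramBilin_UGram_apply])
    (by simp [LambdaB, prodBilin_apply, gramBilin_UGram_apply])
    (by simp [LambdaB, prodBilin_apply, gramBilin_UGram_apply])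
    (by simp [LambdaB, prodBilin_apply, gramBilin_UGram_apply])
    (by simp [LambdaB, prodBilin_apply, gramBilin_UGram_apply])
    (by simp [LambdaB, prodBilin_apply, gramBilin_UGram_apply])
    (by simp [LambdaB, prodBilin_apply, gramBilin_UGram_apply])
    (by simp [LambdaB, prodBilin_apply, gramBilin_UGram_apply])
    hdiv.2.2 (m := -1) (by rw [hgsq]; norm_num)
  convert h using 1
  simp
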